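/- For every integer k ≥ 0: dim ℋ_k = ∑_{i=0}^{min(n,k)} dim ℋ^b_{k−i} · dim ℋ^f_i + ∑_{j=0}^{min(n, k−1)−1} ∑_{l=1}^{min(n−j, ⌊(k−j)/2⌋)} dim ℋ^b_{k−2l−j} · dim ℋ^f_j, where the second (double) sum is empty when k = 0. -/

import Mathlib

set_option synthInstance.maxHeartbeats 1000000
set_option maxHeartbeats 1000000
open scoped TensorProduct
open MvPolynomial

noncomputable section

variable (m n : ℕ)

/-- The Grassmann algebra Λ_{2n} on `2n` anticommuting generators. -/
abbrev Grass (n : ℕ) := ExteriorAlgebra ℝ (Fin (2*n) → ℝ)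

/-- The algebra of super-polynomials 𝒫 = ℝ[x_1,…,x_m] ⊗ Λ_{2n}. -/
abbrev SuperPoly (m n : ℕ) := MvPolynomial (Fin m) ℝ ⊗[ℝ] Grass n

/-- The fermionic generator x`_i. -/
def fgen (i : Fin (2*n)) : Grass n :=
  ExteriorAlgebra.ι ℝ (Pi.single i (1:ℝ))

/-- The fermionic partial derivative ∂_{x`_i}, the odd derivation with
∂_{x`_i}(x`_j) = δ_{ij}: contraction with the i-th dual basis vector. -/
def fpderiv (i : Fin (2*n)) : Grass n →ₗ[ℝ] Grass n :=
  CliffordAlgebra.contractLeft (LinearMap.proj i)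

/-- The fermionic Laplace operator on Λ_{2n}. -/
def lapF : Grass n →ₗ[ℝ] Grass n :=
  (4:ℝ) • ∑ j : Fin n,
    (fpderiv n ⟨2*j.1, by omega⟩) ∘ₗ (fpderiv n ⟨2*j.1+1, by omega⟩)

/-- The bosonic Laplace operator Δ_b = −∑ ∂_{x_j}² on ℝ[x_1,…,x_m]. -/
def lapB : MvPolynomial (Fin m) ℝ →ₗ[ℝ] MvPolynomial (Fin m) ℝ :=
  - ∑ j : Fin m, (pderiv j).toLinearMap ∘ₗ (pderiv j).toLinearMap

/-- The super Laplace operator Δ = Δ_b + Δ_f on 𝒫. -/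
def lap : SuperPoly m n →ₗ[ℝ] SuperPoly m n :=
  LinearMap.rTensor (Grass n) (lapB m) + LinearMap.lTensor (MvPolynomial (Fin m) ℝ) (lapF n)

/-- x̲² = −∑ x_j². -/
def rb2 : MvPolynomial (Fin m) ℝ := - ∑ j : Fin m, (X j)^2

/-- x`² = ∑_{j=1}^n x`_{2j−1} x`_{2j}. -/
def rf2 : Grass n := ∑ j : Fin n, fgen n ⟨2*j.1, by omega⟩ * fgen n ⟨2*j.1+1, by omega⟩

/-- The generalized norm squared x² = x̲² + x`² as an element of 𝒫. -/
def r2 : SuperPoly m n := (rb2 m) ⊗ₜ 1 + 1 ⊗ₜ (rf2 n)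

/-- The grade-`i` part of the Grassmann algebra. -/
def fgrade (i : ℕ) : Submodule ℝ (Grass n) :=
  (LinearMap.range (ExteriorAlgebra.ι ℝ (M := Fin (2*n) → ℝ)))^i

/-- The space 𝒫_k of super-polynomials homogeneous of total degree k. -/
def P (k : ℕ) : Submodule ℝ (SuperPoly m n) :=
  ⨆ i : Fin (k+1), Submodule.map₂ (TensorProduct.mk ℝ _ _)
    (homogeneousSubmodule (Fin m) ℝ (k - i.1)) (fgrade n i.1)

/-- The space ℋ_k of spherical harmonics of degree k. -/
def H (k : ℕ) : Submodule ℝ (SuperPoly m n) :=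
  P m n k ⊓ LinearMap.ker (lap m n)

/-- The super-dimension M = m − 2n. -/
def sdim : ℤ := (m : ℤ) - 2*n

/-- ℋ^b_p: classical harmonic polynomials of degree p in x_1,…,x_m. -/
def Hb (p : ℕ) : Submodule ℝ (MvPolynomial (Fin m) ℝ) :=
  homogeneousSubmodule (Fin m) ℝ p ⊓ LinearMap.ker (lapB m)

/-- ℋ^f_q: fermionic (symplectic) harmonics of degree q. -/
def Hf (q : ℕ) : Submodule ℝ (Grass n) :=
  fgrade n q ⊓ LinearMap.ker (lapF n)

/-- ℋ^b_p · ℋ^f_q: the span in 𝒫 of the products H^b H^f. -/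
def HbHf (p q : ℕ) : Submodule ℝ (SuperPoly m n) :=
  Submodule.map₂ (TensorProduct.mk ℝ _ _) (Hb m p) (Hf n q)

/-- A family of submodules separated by projections has a supremum of additive dimension. -/
theorem finrank_iSup_of_proj {ι K V : Type*} [Fintype ι] [Field K] [AddCommGroup V] [Module K V]
    (S : ι → Submodule K V) [∀ i, Module.Finite K (S i)] (π : ι → V →ₗ[K] V)
    (h_self : ∀ i, ∀ v ∈ S i, π i v = v) (h_ne : ∀ i j, i ≠ j → ∀ v ∈ S j, π i v = 0) :
    Module.finrank K ↥(⨆ i, S i) = ∑ i, Module.finrank K (S i) := by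
  classical
  have hind : iSupIndep S := by
    rw [iSupIndep_iff_finsetSum_eq_zero_imp_eq_zero]
    intro s v hv h0 i hi
    have h1 := congrArg (π i) h0
    rw [map_sum, map_zero, Finset.sum_eq_single_of_mem i hi
      (fun j hj hji => h_ne i j hji.symm _ (hv j hj)), h_self i _ (hv i hi)] at h1
    exact h1
  rw [← Module.finrank_directSum, Submodule.iSup_eq_range_dfinsupp_lsum]
  exact LinearMap.finrank_range_of_inj hind.dfinsupp_lsum_injective

theorem finrank_map₂_mk {K V W : Type*} [Field K] [AddCommGroup V] [Module K V]
    [AddCommGroup W] [Module K W] (S : Submodule K V) (T : Submodule K W) :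
    Module.finrank K ↥(Submodule.map₂ (TensorProduct.mk K V W) S T) =
      Module.finrank K S * Module.finrank K T := by
  rw [← TensorProduct.range_mapIncl, LinearMap.finrank_range_of_inj
    (Module.Flat.tensorProduct_mapIncl_injective_of_right S T), Module.finrank_tensorProduct]

/-- Rank-nullity for an operator mapping one submodule onto another. -/
theorem finrank_inf_ker_add {K V : Type*} [Field K] [AddCommGroup V] [Module K V]
    (D : V →ₗ[K] V) (S T : Submodule K V) [Module.Finite K S]
    (h_maps : ∀ v ∈ S, D v ∈ T) (h_onto : ∀ w ∈ T, ∃ v ∈ S, D v = w) :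
    Module.finrank K ↥(S ⊓ LinearMap.ker D) + Module.finrank K T = Module.finrank K S := by
  have h_range : LinearMap.range (D.domRestrict S) = T := by
    ext w
    constructor
    · rintro ⟨v, rfl⟩
      exact h_maps v v.2
    · intro hw
      obtain ⟨v, hv, rfl⟩ := h_onto w hw
      exact ⟨⟨v, hv⟩, rfl⟩
  have h_ker : Module.finrank K ↥(LinearMap.ker (D.domRestrict S)) =
      Module.finrank K ↥(S ⊓ LinearMap.ker D) := by
    rw [LinearMap.ker_domRestrict, ← Submodule.finrank_map_subtype_eq, Submodule.map_comap_subtype]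
  rw [← (D.domRestrict S).finrank_range_add_finrank_ker, h_range, h_ker, add_comm]

/-- The `𝔰𝔩₂` argument: if a lowering operator `F` and a raising operator `E` commute on the
degree-`p` part up to a scalar which is positive for `p < N`, then `F` maps degree `p + 2` onto
degree `p` for `p < N`. -/
theorem exists_lowering_eq {V : Type*} [AddCommGroup V] [Module ℝ V]
    (S : ℕ → Submodule ℝ V) [∀ p, Module.Finite ℝ (S p)] (F E : V →ₗ[ℝ] V) (c : ℕ → ℝ) (N : ℕ)
    (hF : ∀ p, ∀ v ∈ S (p + 2), F v ∈ S p) (hF₀ : ∀ p < 2, ∀ v ∈ S p, F v = 0)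
    (hE : ∀ p, ∀ v ∈ S p, E v ∈ S (p + 2))
    (hFE : ∀ p, ∀ v ∈ S p, F (E v) = E (F v) + c p • v) (hc : ∀ p < N, 0 < c p)
    {p : ℕ} (hp : p < N) {w : V} (hw : w ∈ S p) : ∃ v ∈ S (p + 2), F v = w := by
  have h_inj : ∀ q < N, ∀ t : ℝ, 0 < t → ∀ v ∈ S q, E (F v) + t • v = 0 → v = 0 := by
    intro q
    induction q using Nat.strong_induction_on with
    | _ q ih =>
      intro hq t ht v hv h
      have hFv : F v = 0 := by
        rcases lt_or_ge q 2 with h2 | h2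
        · exact hF₀ q h2 v hv
        · obtain ⟨r, rfl⟩ := Nat.exists_eq_add_of_le' h2
          have hr : F v ∈ S r := hF r v hv
          refine ih r (by omega) (by omega) (c r + t) (add_pos (hc r (by omega)) ht) _ hr ?_
          have := congrArg F h
          rw [map_add, map_smul, map_zero, hFE r _ hr] at this
          rw [add_smul, ← add_assoc, this]
      rw [hFv, map_zero, zero_add] at h
      exact (smul_eq_zero.mp h).resolve_left ht.ne'
  let G : S p →ₗ[ℝ] S p := (F ∘ₗ E).restrict fun v hv => hF p _ (hE p v hv)
  have hG : Function.Injective G := by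
    rw [injective_iff_map_eq_zero]
    intro v hv
    apply Subtype.ext
    refine h_inj p hp (c p) (hc p hp) v v.2 ?_
    rw [← hFE p v v.2]
    exact congrArg Subtype.val hv
  obtain ⟨v, hv⟩ := LinearMap.injective_iff_surjective.mp hG ⟨w, hw⟩
  exact ⟨E v, hE p v v.2, congrArg Subtype.val hv⟩

section Bosonic

instance (p : ℕ) : Module.Finite ℝ (homogeneousSubmodule (Fin m) ℝ p) :=
  Module.Finite.iff_fg.mpr (homogeneousSubmodule_fg _ _ p)

theorem lapB_apply (f : MvPolynomial (Fin m) ℝ) :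
    lapB m f = -∑ j, pderiv j (pderiv j f) := by
  simp [lapB]

theorem lapB_mem {p : ℕ} {f : MvPolynomial (Fin m) ℝ}
    (hf : f ∈ homogeneousSubmodule (Fin m) ℝ (p + 2)) :
    lapB m f ∈ homogeneousSubmodule (Fin m) ℝ p := by
  rw [lapB_apply]
  exact neg_mem (sum_mem fun j _ => IsHomogeneous.pderiv (IsHomogeneous.pderiv hf))

theorem lapB_eq_zero {p : ℕ} (hp : p < 2) {f : MvPolynomial (Fin m) ℝ}
    (hf : f ∈ homogeneousSubmodule (Fin m) ℝ p) : lapB m f = 0 := by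
  rw [lapB_apply, neg_eq_zero]
  refine Finset.sum_eq_zero fun j _ => ?_
  have h : (pderiv j f).IsHomogeneous 0 := by
    have := IsHomogeneous.pderiv (i := j) hf
    rwa [show p - 1 = 0 by omega] at this
  rw [← totalDegree_zero_iff_isHomogeneous, totalDegree_eq_zero_iff_eq_C] at h
  rw [h, pderiv_C]

theorem rb2_isHomogeneous : (rb2 m).IsHomogeneous 2 := by
  rw [← mem_homogeneousSubmodule]
  refine neg_mem (sum_mem fun j _ => ?_)
  simpa using (isHomogeneous_X ℝ j).pow 2

theorem pderiv_rb2 (j : Fin m) : pderiv j (rb2 m) = -(2 * X j) := by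
  simp [rb2, Derivation.leibniz_pow, pderiv_X, Pi.single_apply]

theorem lapB_rb2_mul {p : ℕ} {f : MvPolynomial (Fin m) ℝ}
    (hf : f ∈ homogeneousSubmodule (Fin m) ℝ p) :
    lapB m (rb2 m * f) = rb2 m * lapB m f + (2 * m + 4 * p : ℝ) • f := by
  have h : ∀ j, pderiv j (pderiv j (rb2 m * f)) =
      rb2 m * pderiv j (pderiv j f) - 4 * (X j * pderiv j f) - 2 * f := by
    intro j
    have h_two : pderiv j (2 : MvPolynomial (Fin m) ℝ) = 0 :=
      mod_cast (pderiv j).map_natCast 2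
    simp [pderiv_rb2, Derivation.leibniz, h_two]
    ring
  have h_euler := IsHomogeneous.sum_X_mul_pderiv (φ := f) hf
  simp only [lapB_apply, h, Finset.sum_sub_distrib, ← Finset.mul_sum, h_euler]
  simp [MvPolynomial.smul_eq_C_mul, map_ofNat]
  ring

theorem exists_lapB_eq (hm : 1 ≤ m) {p : ℕ} {g : MvPolynomial (Fin m) ℝ}
    (hg : g ∈ homogeneousSubmodule (Fin m) ℝ p) :
    ∃ f ∈ homogeneousSubmodule (Fin m) ℝ (p + 2), lapB m f = g := by
  refine exists_lowering_eq (homogeneousSubmodule (Fin m) ℝ) (lapB m)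
    (LinearMap.mulLeft ℝ (rb2 m)) (fun p => 2 * m + 4 * p) (p + 1)
    (fun _ _ => lapB_mem m) (fun _ hp _ => lapB_eq_zero m hp) (fun q f hf => ?_)
    (fun _ _ => lapB_rb2_mul m) (fun q _ => ?_) p.lt_succ_self hg
  · rw [add_comm]
    exact (rb2_isHomogeneous m).mul hf
  · have : (0 : ℝ) < m := by exact_mod_cast hm
    positivity

end Bosonic

section Fermionic

instance (p : ℕ) : Module.Finite ℝ (fgrade n p) :=
  exteriorPower.instFinite (R := ℝ) (M := Fin (2 * n) → ℝ) (n := p)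

theorem finrank_fgrade (p : ℕ) : Module.finrank ℝ (fgrade n p) = (2 * n).choose p := by
  have h := exteriorPower.finrank_eq (R := ℝ) (M := Fin (2 * n) → ℝ) (n := p)
  rwa [Module.finrank_fin_fun] at h

theorem fpderiv_ι_mul (i : Fin (2 * n)) (v : Fin (2 * n) → ℝ) (ω : Grass n) :
    fpderiv n i (ExteriorAlgebra.ι ℝ v * ω) =
      v i • ω - ExteriorAlgebra.ι ℝ v * fpderiv n i ω :=
  CliffordAlgebra.contractLeft_ι_mul _ v ω

theorem fpderiv_fgen_mul (i j : Fin (2 * n)) (ω : Grass n) :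
    fpderiv n i (fgen n j * ω) = (if i = j then (1 : ℝ) else 0) • ω - fgen n j * fpderiv n i ω := by
  rw [fgen, fpderiv_ι_mul, Pi.single_apply]

theorem ι_mul_mem {p : ℕ} (v : Fin (2 * n) → ℝ) {ω : Grass n} (hω : ω ∈ fgrade n p) :
    ExteriorAlgebra.ι ℝ v * ω ∈ fgrade n (p + 1) := by
  rw [fgrade, pow_succ']
  exact Submodule.mul_mem_mul (LinearMap.mem_range_self _ v) hω

theorem fpderiv_mem_aux (i : Fin (2 * n)) {p : ℕ} {ω : Grass n} (hω : ω ∈ fgrade n p) :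
    (p = 0 → fpderiv n i ω = 0) ∧ ∀ q, p = q + 1 → fpderiv n i ω ∈ fgrade n q := by
  induction hω using Submodule.pow_induction_on_left' with
  | algebraMap r =>
    exact ⟨fun _ => CliffordAlgebra.contractLeft_algebraMap _ _ r, fun q h => by omega⟩
  | add x y k _ _ hx hy =>
    refine ⟨fun h => by rw [map_add, hx.1 h, hy.1 h, add_zero], fun q h => ?_⟩
    rw [map_add]
    exact add_mem (hx.2 q h) (hy.2 q h)
  | mem_mul a ha k x hx ih =>
    obtain ⟨v, rfl⟩ := ha
    refine ⟨fun h => by omega, fun q h => ?_⟩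
    obtain rfl : k = q := by omega
    rw [fpderiv_ι_mul]
    refine sub_mem (Submodule.smul_mem _ _ hx) ?_
    rcases k with _ | k
    · rw [ih.1 rfl, mul_zero]
      exact zero_mem _
    · exact ι_mul_mem n v (ih.2 k rfl)

theorem fpderiv_mem (i : Fin (2 * n)) {p : ℕ} {ω : Grass n} (hω : ω ∈ fgrade n (p + 1)) :
    fpderiv n i ω ∈ fgrade n p :=
  (fpderiv_mem_aux n i hω).2 p rfl

theorem fpderiv_eq_zero (i : Fin (2 * n)) {ω : Grass n} (hω : ω ∈ fgrade n 0) :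
    fpderiv n i ω = 0 :=
  (fpderiv_mem_aux n i hω).1 rfl

theorem sum_fgen_mul_fpderiv_ι_mul (v : Fin (2 * n) → ℝ) (ω : Grass n) :
    ∑ i, fgen n i * fpderiv n i (ExteriorAlgebra.ι ℝ v * ω) =
      ExteriorAlgebra.ι ℝ v * ω + ExteriorAlgebra.ι ℝ v * ∑ i, fgen n i * fpderiv n i ω := by
  have hv : ExteriorAlgebra.ι ℝ v = ∑ i, v i • fgen n i := by
    conv_lhs => rw [pi_eq_sum_univ' v]
    simp [fgen]
  have h_anti : ∀ i, fgen n i * ExteriorAlgebra.ι ℝ v = -(ExteriorAlgebra.ι ℝ v * fgen n i) :=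
    fun i => eq_neg_of_add_eq_zero_left (ExteriorAlgebra.ι_add_mul_swap _ _)
  have h : ∀ i, fgen n i * fpderiv n i (ExteriorAlgebra.ι ℝ v * ω) =
      v i • fgen n i * ω + ExteriorAlgebra.ι ℝ v * (fgen n i * fpderiv n i ω) := by
    intro i
    rw [fpderiv_ι_mul, mul_sub, mul_smul_comm, smul_mul_assoc, ← mul_assoc, h_anti, neg_mul,
      sub_neg_eq_add, mul_assoc]
  rw [Finset.sum_congr rfl fun i _ => h i, Finset.sum_add_distrib, ← Finset.sum_mul, ← hv,
    Finset.mul_sum]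

/-- Euler's identity on the Grassmann algebra. -/
theorem sum_fgen_mul_fpderiv {p : ℕ} {ω : Grass n} (hω : ω ∈ fgrade n p) :
    ∑ i, fgen n i * fpderiv n i ω = (p : ℝ) • ω := by
  induction hω using Submodule.pow_induction_on_left' with
  | algebraMap r =>
    have h : ∀ i, fpderiv n i (algebraMap ℝ (Grass n) r) = 0 :=
      fun i => CliffordAlgebra.contractLeft_algebraMap _ _ r
    simp only [h, mul_zero, Finset.sum_const_zero, Nat.cast_zero, zero_smul]
  | add x y k _ _ hx hy => simp only [map_add, mul_add, Finset.sum_add_distrib, hx, hy, smul_add]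
  | mem_mul a ha k x hx ih =>
    obtain ⟨v, rfl⟩ := ha
    rw [sum_fgen_mul_fpderiv_ι_mul, ih, mul_smul_comm, Nat.cast_succ, add_smul, one_smul, add_comm]

theorem lapF_apply (ω : Grass n) :
    lapF n ω = (4 : ℝ) • ∑ j : Fin n,
      fpderiv n ⟨2 * j.1, by omega⟩ (fpderiv n ⟨2 * j.1 + 1, by omega⟩ ω) := by
  simp [lapF]

theorem lapF_mem {p : ℕ} {ω : Grass n} (hω : ω ∈ fgrade n (p + 2)) : lapF n ω ∈ fgrade n p := by
  rw [lapF_apply]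
  exact Submodule.smul_mem _ _ (sum_mem fun j _ => fpderiv_mem n _ (fpderiv_mem n _ hω))

theorem lapF_eq_zero {p : ℕ} (hp : p < 2) {ω : Grass n} (hω : ω ∈ fgrade n p) :
    lapF n ω = 0 := by
  rw [lapF_apply, Finset.sum_eq_zero, smul_zero]
  intro j _
  interval_cases p
  · rw [fpderiv_eq_zero n _ hω, map_zero]
  · exact fpderiv_eq_zero n _ (fpderiv_mem n _ hω)

theorem rf2_mul_mem {p : ℕ} {ω : Grass n} (hω : ω ∈ fgrade n p) :
    rf2 n * ω ∈ fgrade n (p + 2) := by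
  rw [rf2, Finset.sum_mul]
  refine sum_mem fun j _ => ?_
  rw [mul_assoc]
  exact ι_mul_mem n _ (ι_mul_mem n _ hω)

theorem sum_fin_two_mul {A : Type*} [AddCommMonoid A] (f : Fin (2 * n) → A) :
    ∑ i, f i = ∑ j : Fin n, (f ⟨2 * j.1, by omega⟩ + f ⟨2 * j.1 + 1, by omega⟩) := by
  induction n with
  | zero => rfl
  | succ n ih =>
    rw [Fin.sum_univ_castSucc (n := n)]
    refine (Fin.sum_univ_castSucc (n := 2 * n + 1) f).trans ?_
    rw [Fin.sum_univ_castSucc (n := 2 * n), ih, add_assoc]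
    rfl

theorem lapF_rf2_mul {p : ℕ} {ω : Grass n} (hω : ω ∈ fgrade n p) :
    lapF n (rf2 n * ω) = rf2 n * lapF n ω - (4 * (n - p) : ℝ) • ω := by
  have h_term : ∀ j k : Fin n,
      fpderiv n ⟨2 * j.1, by omega⟩ (fpderiv n ⟨2 * j.1 + 1, by omega⟩
        (fgen n ⟨2 * k.1, by omega⟩ * fgen n ⟨2 * k.1 + 1, by omega⟩ * ω)) =
      fgen n ⟨2 * k.1, by omega⟩ * fgen n ⟨2 * k.1 + 1, by omega⟩ *
        fpderiv n ⟨2 * j.1, by omega⟩ (fpderiv n ⟨2 * j.1 + 1, by omega⟩ ω) +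
      (if j = k then (1 : ℝ) else 0) •
        (fgen n ⟨2 * k.1, by omega⟩ * fpderiv n ⟨2 * k.1, by omega⟩ ω +
          fgen n ⟨2 * k.1 + 1, by omega⟩ * fpderiv n ⟨2 * k.1 + 1, by omega⟩ ω - ω) := by
    intro j k
    have h₁ : ¬ 2 * j.1 + 1 = 2 * k.1 := by omega
    have h₂ : ¬ 2 * j.1 = 2 * k.1 + 1 := by omega
    by_cases hjk : j = k
    · subst hjk
      simp only [mul_assoc, fpderiv_fgen_mul, map_sub, Fin.mk.injEq, h₁, h₂, if_true,
        if_false, one_smul, zero_smul, mul_sub, map_zero, mul_zero]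
      abel
    · have h₃ : ¬ 2 * j.1 = 2 * k.1 := fun h => hjk (Fin.ext (by omega))
      have h₄ : ¬ 2 * j.1 + 1 = 2 * k.1 + 1 := fun h => hjk (Fin.ext (by omega))
      simp only [mul_assoc, fpderiv_fgen_mul, map_sub, Fin.mk.injEq, h₁, h₂, h₃, h₄,
        hjk, if_false, zero_smul, mul_sub]
      simp
  have h_euler := sum_fgen_mul_fpderiv n hω
  rw [sum_fin_two_mul] at h_euler
  rw [lapF_apply, lapF_apply, rf2, Finset.sum_mul]
  simp only [map_sum, h_term, Finset.sum_add_distrib, ite_smul, one_smul, zero_smul,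
    Finset.sum_ite_eq, Finset.mem_univ, if_true]
  rw [Finset.sum_sub_distrib, h_euler, Finset.sum_const, Finset.card_univ, Fintype.card_fin,
    ← Nat.cast_smul_eq_nsmul ℝ, Finset.sum_comm, mul_smul_comm, Finset.sum_mul_sum]
  module

theorem exists_lapF_eq {p : ℕ} (hp : p < n) {η : Grass n} (hη : η ∈ fgrade n p) :
    ∃ ω ∈ fgrade n (p + 2), lapF n ω = η := by
  refine exists_lowering_eq (fgrade n) (lapF n) (-LinearMap.mulLeft ℝ (rf2 n))
    (fun p => 4 * (n - p)) n (fun _ _ => lapF_mem n) (fun _ hp _ => lapF_eq_zero n hp)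
    (fun q ω hω => neg_mem (rf2_mul_mem n hω)) (fun q ω hω => ?_) (fun q hq => ?_) hp hη
  · simp only [LinearMap.neg_apply, LinearMap.mulLeft_apply, map_neg, lapF_rf2_mul n hω]
    abel
  · have : (q : ℝ) < n := by exact_mod_cast hq
    linarith

end Fermionic

section Super

theorem tmul_mem_P {p i k : ℕ} (hk : p + i = k) {b : MvPolynomial (Fin m) ℝ} {ω : Grass n}
    (hb : b ∈ homogeneousSubmodule (Fin m) ℝ p) (hω : ω ∈ fgrade n i) :
    b ⊗ₜ[ℝ] ω ∈ P m n k := by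
  obtain rfl : p = k - i := by omega
  exact Submodule.mem_iSup_of_mem (⟨i, by omega⟩ : Fin (k + 1))
    (Submodule.apply_mem_map₂ _ hb hω)

theorem P_le {k : ℕ} {T : Submodule ℝ (SuperPoly m n)}
    (h : ∀ p i, p + i = k → ∀ b ∈ homogeneousSubmodule (Fin m) ℝ p, ∀ ω ∈ fgrade n i,
      b ⊗ₜ[ℝ] ω ∈ T) : P m n k ≤ T :=
  iSup_le fun i => Submodule.map₂_le.mpr fun b hb ω hω => h (k - i) i (by omega) b hb ω hω

theorem lap_tmul (b : MvPolynomial (Fin m) ℝ) (ω : Grass n) :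
    lap m n (b ⊗ₜ[ℝ] ω) = lapB m b ⊗ₜ[ℝ] ω + b ⊗ₜ[ℝ] lapF n ω := by
  simp [lap]

theorem lap_mem {k : ℕ} {v : SuperPoly m n} (hv : v ∈ P m n (k + 2)) : lap m n v ∈ P m n k := by
  revert v
  suffices h : P m n (k + 2) ≤ (P m n k).comap (lap m n) from fun {v} hv => h hv
  refine P_le m n fun p i hpi b hb ω hω => ?_
  rw [Submodule.mem_comap, lap_tmul]
  refine add_mem ?_ ?_
  · rcases lt_or_ge p 2 with hp | hp
    · rw [lapB_eq_zero m hp hb, TensorProduct.zero_tmul]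
      exact zero_mem _
    · obtain ⟨q, rfl⟩ := Nat.exists_eq_add_of_le' hp
      exact tmul_mem_P m n (by omega) (lapB_mem m hb) hω
  · rcases lt_or_ge i 2 with hi | hi
    · rw [lapF_eq_zero n hi hω, TensorProduct.tmul_zero]
      exact zero_mem _
    · obtain ⟨q, rfl⟩ := Nat.exists_eq_add_of_le' hi
      exact tmul_mem_P m n (by omega) hb (lapF_mem n hω)

theorem lap_eq_zero {k : ℕ} (hk : k < 2) {v : SuperPoly m n} (hv : v ∈ P m n k) :
    lap m n v = 0 := by
  revert v
  suffices h : P m n k ≤ LinearMap.ker (lap m n) from fun {v} hv => h hv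
  refine P_le m n fun p i hpi b hb ω hω => ?_
  rw [LinearMap.mem_ker, lap_tmul, lapB_eq_zero m (by omega) hb, lapF_eq_zero n (by omega) hω,
    TensorProduct.zero_tmul, TensorProduct.tmul_zero, add_zero]

theorem tmul_mem_map_lap (hm : 1 ≤ m) (i : ℕ) : ∀ (p k : ℕ), p + i = k →
    ∀ b ∈ homogeneousSubmodule (Fin m) ℝ p, ∀ ω ∈ fgrade n i,
      b ⊗ₜ[ℝ] ω ∈ (P m n (k + 2)).map (lap m n) := by
  induction i using Nat.strong_induction_on with
  | _ i ih =>
    intro p k hk b hb ω hω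
    obtain ⟨a, ha, rfl⟩ := exists_lapB_eq m hm hb
    rw [← add_sub_cancel_right (lapB m a ⊗ₜ[ℝ] ω) (a ⊗ₜ[ℝ] lapF n ω), ← lap_tmul]
    refine sub_mem (Submodule.mem_map_of_mem (tmul_mem_P m n (by omega) ha hω)) ?_
    rcases lt_or_ge i 2 with hi | hi
    · rw [lapF_eq_zero n hi hω, TensorProduct.tmul_zero]
      exact zero_mem _
    · obtain ⟨q, rfl⟩ := Nat.exists_eq_add_of_le' hi
      exact ih q (by omega) (p + 2) k (by omega) a ha _ (lapF_mem n hω)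

theorem exists_lap_eq (hm : 1 ≤ m) {k : ℕ} {w : SuperPoly m n} (hw : w ∈ P m n k) :
    ∃ v ∈ P m n (k + 2), lap m n v = w :=
  P_le m n (fun p i => tmul_mem_map_lap m n hm i p k) hw

instance (p i : ℕ) : Module.Finite ℝ ↥(Submodule.map₂ (TensorProduct.mk ℝ _ _)
    (homogeneousSubmodule (Fin m) ℝ p) (fgrade n i)) := by
  rw [← TensorProduct.range_mapIncl]
  infer_instance

instance (k : ℕ) : Module.Finite ℝ (P m n k) :=
  Submodule.finite_iSup _

/-- The projection of the Grassmann algebra onto its grade-`i` part. -/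
def fproj (i : ℕ) : Grass n →ₗ[ℝ] Grass n :=
  GradedAlgebra.proj (fun j : ℕ => ⋀[ℝ]^j (Fin (2 * n) → ℝ)) i

theorem fproj_of_mem {i : ℕ} {ω : Grass n} (hω : ω ∈ fgrade n i) : fproj n i ω = ω :=
  DirectSum.decompose_of_mem_same (fun j : ℕ => ⋀[ℝ]^j (Fin (2 * n) → ℝ)) hω

theorem fproj_of_mem_ne {i j : ℕ} (hij : i ≠ j) {ω : Grass n} (hω : ω ∈ fgrade n j) :
    fproj n i ω = 0 :=
  DirectSum.decompose_of_mem_ne (fun j : ℕ => ⋀[ℝ]^j (Fin (2 * n) → ℝ)) hω hij.symm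

theorem finrank_P (k : ℕ) : Module.finrank ℝ (P m n k) = ∑ i ∈ Finset.range (k + 1),
    Module.finrank ℝ (homogeneousSubmodule (Fin m) ℝ (k - i)) * (2 * n).choose i := by
  have h_self : ∀ i : Fin (k + 1), Submodule.map₂ (TensorProduct.mk ℝ _ _)
      (homogeneousSubmodule (Fin m) ℝ (k - i)) (fgrade n i) ≤
      LinearMap.eqLocus (LinearMap.lTensor _ (fproj n i)) LinearMap.id := by
    refine fun i => Submodule.map₂_le.mpr fun b hb ω hω => ?_
    rw [LinearMap.mem_eqLocus, TensorProduct.mk_apply, LinearMap.lTensor_tmul,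
      fproj_of_mem n hω, LinearMap.id_apply]
  have h_ne : ∀ i j : Fin (k + 1), i ≠ j → Submodule.map₂ (TensorProduct.mk ℝ _ _)
      (homogeneousSubmodule (Fin m) ℝ (k - j)) (fgrade n j) ≤
      LinearMap.ker (LinearMap.lTensor _ (fproj n i)) := by
    refine fun i j hij => Submodule.map₂_le.mpr fun b hb ω hω => ?_
    rw [LinearMap.mem_ker, TensorProduct.mk_apply, LinearMap.lTensor_tmul,
      fproj_of_mem_ne n (Fin.val_ne_of_ne hij) hω, TensorProduct.tmul_zero]
  rw [P, finrank_iSup_of_proj _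
    (fun i : Fin (k + 1) => LinearMap.lTensor (MvPolynomial (Fin m) ℝ) (fproj n i))
    (fun i _ hv => h_self i hv) (fun i j hij _ hv => h_ne i j hij hv), ← Fin.sum_univ_eq_sum_range
    (fun i => Module.finrank ℝ (homogeneousSubmodule (Fin m) ℝ (k - i)) * (2 * n).choose i)]
  exact Finset.sum_congr rfl fun i _ => by rw [finrank_map₂_mk, finrank_fgrade]

theorem finrank_Hb_of_lt {p : ℕ} (hp : p < 2) :
    Module.finrank ℝ (Hb m p) = Module.finrank ℝ (homogeneousSubmodule (Fin m) ℝ p) := by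
  rw [Hb, inf_eq_left.mpr fun f hf => lapB_eq_zero m hp hf]

theorem finrank_Hb_add (hm : 1 ≤ m) (p : ℕ) : Module.finrank ℝ (Hb m (p + 2)) +
      Module.finrank ℝ (homogeneousSubmodule (Fin m) ℝ p) =
    Module.finrank ℝ (homogeneousSubmodule (Fin m) ℝ (p + 2)) :=
  finrank_inf_ker_add _ _ _ (fun _ => lapB_mem m) fun _ => exists_lapB_eq m hm

theorem finrank_Hf_of_lt {p : ℕ} (hp : p < 2) :
    Module.finrank ℝ (Hf n p) = (2 * n).choose p := by
  rw [Hf, inf_eq_left.mpr fun f hf => lapF_eq_zero n hp hf, finrank_fgrade]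

theorem finrank_Hf_add {p : ℕ} (hp : p < n) :
    Module.finrank ℝ (Hf n (p + 2)) + (2 * n).choose p = (2 * n).choose (p + 2) := by
  rw [← finrank_fgrade, ← finrank_fgrade]
  exact finrank_inf_ker_add _ _ _ (fun _ => lapF_mem n) fun _ => exists_lapF_eq n hp

theorem finrank_H (hm : 1 ≤ m) (k : ℕ) : Module.finrank ℝ (H m n k) =
    ∑ i ∈ Finset.range (k + 1), Module.finrank ℝ (Hb m (k - i)) * (2 * n).choose i := by
  rcases lt_or_ge k 2 with hk | hk
  · rw [H, inf_eq_left.mpr fun f hf => lap_eq_zero m n hk hf, finrank_P]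
    exact Finset.sum_congr rfl fun i _ => by rw [finrank_Hb_of_lt m (by omega)]
  · obtain ⟨q, rfl⟩ := Nat.exists_eq_add_of_le' hk
    have h : Module.finrank ℝ (H m n (q + 2)) + Module.finrank ℝ (P m n q) =
        Module.finrank ℝ (P m n (q + 2)) :=
      finrank_inf_ker_add _ _ _ (fun _ => lap_mem m n) fun _ => exists_lap_eq m n hm
    refine Nat.add_right_cancel (h.trans ?_)
    rw [finrank_P, finrank_P, Finset.sum_range_succ _ (q + 2), Finset.sum_range_succ _ (q + 1),
      Finset.sum_range_succ _ (q + 2), Finset.sum_range_succ _ (q + 1),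
      finrank_Hb_of_lt m (p := q + 2 - (q + 1)) (by omega),
      finrank_Hb_of_lt m (p := q + 2 - (q + 2)) (by omega), add_right_comm,
      add_right_comm _ _ (∑ i ∈ Finset.range (q + 1), _),
      add_right_comm _ _ (∑ i ∈ Finset.range (q + 1), _), ← Finset.sum_add_distrib]
    rw [add_right_comm]
    congr 2
    refine Finset.sum_congr rfl fun i hi => ?_
    rw [← add_mul, Nat.sub_add_comm (by simpa [Nat.lt_succ_iff] using hi), finrank_Hb_add m hm]

end Super

section Counting

/-- The dimension count of the Fischer decomposition of the Grassmann algebra. -/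
theorem choose_eq_sum_finrank_Hf (i : ℕ) :
    (2 * n).choose i = ∑ l ∈ (Finset.range (i / 2 + 1)).filter (fun l => i - l ≤ n),
      Module.finrank ℝ (Hf n (i - 2 * l)) := by
  have h_low : ∀ i ≤ n, (2 * n).choose i =
      ∑ l ∈ Finset.range (i / 2 + 1), Module.finrank ℝ (Hf n (i - 2 * l)) := by
    intro i
    induction i using Nat.twoStepInduction with
    | zero => simp [finrank_Hf_of_lt]
    | one => simp [finrank_Hf_of_lt]
    | more i ih _ =>
      intro hi
      rw [show (i + 2) / 2 + 1 = i / 2 + 1 + 1 by omega, Finset.sum_range_succ',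
        ← finrank_Hf_add n (by omega), ih (by omega), add_comm]
      congr 1
      exact Finset.sum_congr rfl fun l _ => by
        rw [show i + 2 - 2 * (l + 1) = i - 2 * l by omega]
  rcases le_or_gt i n with hi | hi
  · rw [h_low i hi, Finset.filter_true_of_mem fun l _ => by omega]
  rcases le_or_gt i (2 * n) with hi' | hi'
  · rw [← Nat.choose_symm hi', h_low _ (by omega)]
    refine Finset.sum_bij' (fun l _ => l + (i - n)) (fun l _ => l - (i - n)) ?_ ?_ ?_ ?_ ?_
    all_goals simp only [Finset.mem_filter, Finset.mem_range]
    · intro l hl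
      omega
    · intro l hl
      omega
    · intro l hl
      omega
    · intro l hl
      omega
    · intro l hl
      rw [show 2 * n - i - 2 * l = i - 2 * (l + (i - n)) by omega]
  · rw [Nat.choose_eq_zero_of_lt hi', Finset.filter_false_of_mem, Finset.sum_empty]
    intro l hl
    rw [Finset.mem_range] at hl
    omega

theorem sum_mul_sum_filter_eq (h f : ℕ → ℕ) (k : ℕ) :
    ∑ i ∈ Finset.range (k + 1), h (k - i) *
        ∑ l ∈ (Finset.range (i / 2 + 1)).filter (fun l => i - l ≤ n), f (i - 2 * l) =
      ∑ j ∈ Finset.range (min n k + 1),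
        ∑ l ∈ Finset.range (min (n - j) ((k - j) / 2) + 1), h (k - 2 * l - j) * f j := by
  simp only [Finset.mul_sum]
  rw [Finset.sum_sigma', Finset.sum_sigma']
  refine Finset.sum_bij' (fun x _ => ⟨x.1 - 2 * x.2, x.2⟩) (fun x _ => ⟨x.1 + 2 * x.2, x.2⟩)
    ?_ ?_ ?_ ?_ ?_
  all_goals
    rintro ⟨a, l⟩
    simp only [Finset.mem_sigma, Finset.mem_filter, Finset.mem_range]
    intro hl
  · omega
  · omega
  · rw [show a - 2 * l + 2 * l = a by omega]
  · rw [show a + 2 * l - 2 * l = a by omega]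
  · rw [show k - 2 * l - (a - 2 * l) = k - a by omega]

theorem sum_range_min_eq_add (h f : ℕ → ℕ) (k : ℕ) :
    ∑ j ∈ Finset.range (min n k + 1),
        ∑ l ∈ Finset.range (min (n - j) ((k - j) / 2) + 1), h (k - 2 * l - j) * f j =
      (∑ i ∈ Finset.range (min n k + 1), h (k - i) * f i) +
      ∑ j ∈ Finset.range (min n (k - 1)),
        ∑ l ∈ Finset.Icc 1 (min (n - j) ((k - j) / 2)), h (k - 2 * l - j) * f j := by
  have h_split : ∀ j, ∑ l ∈ Finset.range (min (n - j) ((k - j) / 2) + 1),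
      h (k - 2 * l - j) * f j = h (k - j) * f j +
        ∑ l ∈ Finset.Icc 1 (min (n - j) ((k - j) / 2)), h (k - 2 * l - j) * f j := by
    intro j
    rw [Finset.range_eq_Ico, Finset.sum_eq_sum_Ico_succ_bot (Nat.succ_pos _)]
    rfl
  simp only [h_split, Finset.sum_add_distrib]
  congr 1
  symm
  refine Finset.sum_subset (Finset.range_mono (by omega)) fun j _ hj => ?_
  rw [Finset.mem_range] at hj
  rw [show min (n - j) ((k - j) / 2) = 0 by omega]
  simp

end Counting

/-- dim ℋ_k = ∑_{i=0}^{min(n,k)} dim ℋ^b_{k−i} dim ℋ^f_i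
+ ∑_{j=0}^{min(n,k−1)−1} ∑_{l=1}^{min(n−j,⌊(k−j)/2⌋)} dim ℋ^b_{k−2l−j} dim ℋ^f_j,
the second sum being empty when k = 0. -/
theorem dim_H_formula (m n : ℕ) (hm : 1 ≤ m) (hn : 1 ≤ n) (k : ℕ) :
    Module.finrank ℝ (H m n k) =
      (∑ i ∈ Finset.range (min n k + 1),
        Module.finrank ℝ (Hb m (k - i)) * Module.finrank ℝ (Hf n i)) +
      (∑ j ∈ Finset.range (min n (k - 1)),
        ∑ l ∈ Finset.Icc 1 (min (n - j) ((k - j)/2)),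
          Module.finrank ℝ (Hb m (k - 2*l - j)) * Module.finrank ℝ (Hf n j)) := by
  rw [finrank_H m n hm, ← sum_range_min_eq_add n (fun p => Module.finrank ℝ (Hb m p))
    (fun p => Module.finrank ℝ (Hf n p)), ← sum_mul_sum_filter_eq n
    (fun p => Module.finrank ℝ (Hb m p)) (fun p => Module.finrank ℝ (Hf n p))]
  simp only [choose_eq_sum_finrank_Hf n]

end
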